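/- (Pickands–Balkema–de Haan theorem, one direction.) Let F be a cumulative distribution function on ℝ with right endpoint x_F = sup{t : F(t) < 1} (possibly +∞), and suppose F lies in the maximum domain of attraction of the generalized extreme value distribution with shape parameter ξ ∈ ℝ, i.e., there exist sequences a_n > 0 and b_n ∈ ℝ such that F(a_n x + b_n)^n → exp(-(1 + ξ x)^{-1/ξ}) for all x with 1 + ξ x > 0 (with the convention exp(-e^{-x}) when ξ = 0). Then there exists a positive measurable function u ↦ σ(u) such that sup_{0 ≤ x < x_F - u} | (F(x + u) - F(u))/(1 - F(u)) - G(x; σ(u), ξ) | → 0 as u → x_F, where G is the generalized Pareto distribution function. -/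

import Mathlib

open Filter Topology

/-- The generalized extreme value (GEV) distribution function with shape `ξ`,
with the convention `exp (-exp (-x))` when `ξ = 0`. -/
noncomputable def gevCDF (ξ x : ℝ) : ℝ :=
  if ξ = 0 then Real.exp (-Real.exp (-x)) else Real.exp (-(1 + ξ * x) ^ (-1 / ξ))

/-- The generalized Pareto distribution (GPD) function with scale `σ` and shape `ξ`:
`G(x; σ, ξ) = 1 - (1 + ξ x / σ)^(-1/ξ)` for `ξ ≠ 0` and `1 - exp (-x/σ)` for `ξ = 0`. -/
noncomputable def gpdCDF (σ ξ x : ℝ) : ℝ :=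
  if ξ = 0 then 1 - Real.exp (-x / σ) else 1 - (1 + ξ * x / σ) ^ (-1 / ξ)

/-- The right endpoint `x_F = sup {t | F t < 1}` of a CDF `F`, as an extended real
(it may be `+∞`). -/
noncomputable def rightEndpoint (F : ℝ → ℝ) : EReal :=
  sSup ((fun t : ℝ => (t : EReal)) '' {t : ℝ | F t < 1})

/-- The inverse of the map `x ↦ -log (gevCDF ξ x)` on `{x | 0 < 1 + ξ * x}`. -/
noncomputable def gevTailInv (ξ s : ℝ) : ℝ :=
  if ξ = 0 then -Real.log s else (s ^ (-ξ) - 1) / ξ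

lemma gevTailInv_one (ξ : ℝ) : gevTailInv ξ 1 = 0 := by
  simp [gevTailInv]

lemma gevTailInv_lt (ξ : ℝ) {s t : ℝ} (hs : 0 < s) (hst : s < t) :
    gevTailInv ξ t < gevTailInv ξ s := by
  unfold gevTailInv
  split_ifs with h
  · exact neg_lt_neg (Real.log_lt_log hs hst)
  · rcases lt_or_gt_of_ne h with h | h
    · rw [div_lt_div_right_of_neg h]
      have := Real.rpow_lt_rpow hs.le hst (neg_pos.2 h)
      linarith
    · rw [div_lt_div_iff_of_pos_right h]
      have := Real.rpow_lt_rpow_of_neg hs hst (neg_lt_zero.2 h)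
      linarith

lemma gevTailInv_le (ξ : ℝ) {s t : ℝ} (hs : 0 < s) (hst : s ≤ t) :
    gevTailInv ξ t ≤ gevTailInv ξ s := by
  rcases hst.eq_or_lt with rfl | h
  · exact le_rfl
  · exact (gevTailInv_lt ξ hs h).le

lemma continuousAt_gevTailInv (ξ : ℝ) {s : ℝ} (hs : 0 < s) :
    ContinuousAt (gevTailInv ξ) s := by
  by_cases h : ξ = 0
  · have : gevTailInv ξ = fun s => -Real.log s := by ext; simp [gevTailInv, h]
    rw [this]
    exact (Real.continuousAt_log hs.ne').neg
  · have : gevTailInv ξ = fun s => (s ^ (-ξ) - 1) / ξ := by ext; simp [gevTailInv, h]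
    rw [this]
    exact ((Real.continuousAt_rpow_const s _ (Or.inl hs.ne')).sub continuousAt_const).div_const _

lemma gevTailInv_mul (ξ : ℝ) {s t : ℝ} (hs : 0 < s) (ht : 0 < t) :
    gevTailInv ξ (s * t) = gevTailInv ξ s + s ^ (-ξ) * gevTailInv ξ t := by
  unfold gevTailInv
  split_ifs with h
  · simp [h, Real.log_mul hs.ne' ht.ne']
    ring
  · rw [Real.mul_rpow hs.le ht.le]
    field_simp
    ring

lemma one_add_mul_gevTailInv {ξ : ℝ} (hξ : ξ ≠ 0) (s : ℝ) :
    1 + ξ * gevTailInv ξ s = s ^ (-ξ) := by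
  simp only [gevTailInv, hξ, if_false]
  field_simp
  ring

lemma one_add_mul_gevTailInv_pos (ξ : ℝ) {s : ℝ} (hs : 0 < s) :
    0 < 1 + ξ * gevTailInv ξ s := by
  by_cases h : ξ = 0
  · simp [h]
  · rw [one_add_mul_gevTailInv h]
    positivity

lemma rpow_neg_rpow_neg_one_div {ξ s : ℝ} (hξ : ξ ≠ 0) (hs : 0 < s) :
    (s ^ (-ξ)) ^ (-1 / ξ) = s := by
  rw [← Real.rpow_mul hs.le, show -ξ * (-1 / ξ) = 1 by field_simp, Real.rpow_one]

lemma gevCDF_gevTailInv (ξ : ℝ) {s : ℝ} (hs : 0 < s) :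
    gevCDF ξ (gevTailInv ξ s) = Real.exp (-s) := by
  by_cases h : ξ = 0
  · simp [gevCDF, gevTailInv, h, Real.exp_log hs]
  · simp only [gevCDF, h, if_false]
    rw [one_add_mul_gevTailInv h, rpow_neg_rpow_neg_one_div h hs]

lemma gpdCDF_mul_gevTailInv (ξ : ℝ) {σ s : ℝ} (hσ : 0 < σ) (hs : 0 < s) :
    gpdCDF σ ξ (σ * gevTailInv ξ s) = 1 - s := by
  by_cases h : ξ = 0
  · simp only [gpdCDF, gevTailInv, h, if_true]
    rw [show -(σ * -Real.log s) / σ = Real.log s by field_simp, Real.exp_log hs]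
  · simp only [gpdCDF, h, if_false]
    rw [show ξ * (σ * gevTailInv ξ s) / σ = ξ * gevTailInv ξ s by field_simp,
      one_add_mul_gevTailInv h, rpow_neg_rpow_neg_one_div h hs]

lemma exists_gevTailInv_eq {ξ z : ℝ} (hz : 0 ≤ z) (h : 0 < 1 + ξ * z) :
    ∃ s, 0 < s ∧ s ≤ 1 ∧ gevTailInv ξ s = z := by
  have key : ∃ s, 0 < s ∧ gevTailInv ξ s = z := by
    by_cases hξ : ξ = 0
    · exact ⟨Real.exp (-z), Real.exp_pos _, by simp [gevTailInv, hξ]⟩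
    · refine ⟨(1 + ξ * z) ^ (-1 / ξ), by positivity, ?_⟩
      simp only [gevTailInv, hξ, if_false]
      rw [← Real.rpow_mul h.le, show -1 / ξ * -ξ = 1 by field_simp, Real.rpow_one]
      field_simp
      ring
  obtain ⟨s, hs, rfl⟩ := key
  refine ⟨s, hs, ?_, rfl⟩
  by_contra! h1
  have := gevTailInv_lt ξ one_pos h1
  rw [gevTailInv_one] at this
  linarith

lemma tendsto_mul_one_sub_of_tendsto_pow {p : ℕ → ℝ} {s : ℝ} (h0 : ∀ n, 0 ≤ p n)
    (h : Tendsto (fun n => p n ^ n) atTop (𝓝 (Real.exp (-s)))) :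
    Tendsto (fun n : ℕ => n * (1 - p n)) atTop (𝓝 s) := by
  have hlog : Tendsto (fun n : ℕ => n * Real.log (p n)) atTop (𝓝 (-s)) := by
    have := (Real.continuousAt_log (Real.exp_pos (-s)).ne').tendsto.comp h
    rw [Real.log_exp] at this
    exact this.congr fun n => by simp [Real.log_pow]
  have hpos : ∀ᶠ n : ℕ in atTop, 0 < p n := by
    filter_upwards [h.eventually (lt_mem_nhds (Real.exp_pos (-s))), eventually_ne_atTop 0]
      with n hn hn0
    exact (h0 n).lt_of_ne fun h' => by simp [← h', hn0] at hn
  have hlog0 : Tendsto (fun n : ℕ => Real.log (p n)) atTop (𝓝 0) := by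
    have := hlog.div_atTop (tendsto_natCast_atTop_atTop (R := ℝ))
    refine this.congr' ?_
    filter_upwards [eventually_ne_atTop 0] with n hn
    field_simp
  have hp : Tendsto p atTop (𝓝 1) := by
    have := (Real.continuous_exp.tendsto 0).comp hlog0
    rw [Real.exp_zero] at this
    refine this.congr' ?_
    filter_upwards [hpos] with n hn
    exact Real.exp_log hn
  have hneg : Tendsto (fun n : ℕ => -(n * Real.log (p n))) atTop (𝓝 s) := by
    simpa using hlog.neg
  have hlow : Tendsto (fun n : ℕ => p n * -(n * Real.log (p n))) atTop (𝓝 s) := by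
    simpa using hp.mul hneg
  refine tendsto_of_tendsto_of_tendsto_of_le_of_le' hlow hneg ?_ ?_
  · filter_upwards [hpos] with n hn
    have h1 := Real.one_sub_inv_le_log_of_pos hn
    have h2 : p n * -Real.log (p n) ≤ 1 - p n := by
      have := mul_le_mul_of_nonneg_left h1 hn.le
      rw [mul_sub, mul_inv_cancel₀ hn.ne'] at this
      linarith
    have := mul_le_mul_of_nonneg_left h2 (Nat.cast_nonneg (α := ℝ) n)
    linarith
  · filter_upwards [hpos] with n hn
    have h1 := Real.log_le_sub_one_of_pos hn
    have := mul_le_mul_of_nonneg_left h1 (Nat.cast_nonneg (α := ℝ) n)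
    linarith

/-- The filter of points at which the survival function `S` is positive and tends to `0`. -/
def tailFilter (S : ℝ → ℝ) : Filter ℝ := comap S (𝓝[>] 0)

lemma tendsto_tailFilter (S : ℝ → ℝ) : Tendsto S (tailFilter S) (𝓝[>] 0) := tendsto_comap

lemma tailFilter_pos (S : ℝ → ℝ) : ∀ᶠ u in tailFilter S, 0 < S u :=
  (tendsto_tailFilter S).eventually self_mem_nhdsWithin

lemma eventually_tailFilter {S : ℝ → ℝ} {P : ℝ → Prop} (h : ∀ᶠ u in tailFilter S, P u) :
    ∃ δ > 0, ∀ u, 0 < S u → S u < δ → P u := by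
  obtain ⟨V, hV, hVP⟩ := mem_comap.1 h
  obtain ⟨δ, hδ, hsub⟩ := mem_nhdsGT_iff_exists_Ioo_subset.1 hV
  exact ⟨δ, hδ, fun u h0 h1 => hVP (hsub ⟨h0, h1⟩)⟩

/-- The index of the normalizing constants attached to the threshold `u`. -/
noncomputable def tailIndex (S : ℝ → ℝ) (u : ℝ) : ℕ := ⌊(S u)⁻¹⌋₊

lemma tendsto_tailIndex (S : ℝ → ℝ) : Tendsto (tailIndex S) (tailFilter S) atTop :=
  tendsto_nat_floor_atTop.comp (tendsto_inv_nhdsGT_zero.comp (tendsto_tailFilter S))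

lemma tendsto_tailIndex_mul (S : ℝ → ℝ) :
    Tendsto (fun u => tailIndex S u * S u) (tailFilter S) (𝓝 1) := by
  have := (tendsto_nat_floor_div_atTop (R := ℝ)).comp
    (tendsto_inv_nhdsGT_zero.comp (tendsto_tailFilter S))
  refine this.congr fun u => ?_
  simp [tailIndex, div_eq_mul_inv]

lemma tendsto_standardized_threshold {S : ℝ → ℝ} (hS : Antitone S) {ξ : ℝ} {a b : ℕ → ℝ}
    (ha : ∀ n, 0 < a n)
    (h : ∀ s, 0 < s → Tendsto (fun n : ℕ => n * S (a n * gevTailInv ξ s + b n)) atTop (𝓝 s)) :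
    Tendsto (fun u => (u - b (tailIndex S u)) / a (tailIndex S u)) (tailFilter S) (𝓝 0) := by
  have h' : ∀ s : ℝ, 0 < s → Tendsto (fun u => tailIndex S u *
      S (a (tailIndex S u) * gevTailInv ξ s + b (tailIndex S u))) (tailFilter S) (𝓝 s) :=
    fun s hs => (h s hs).comp (tendsto_tailIndex S)
  have hq : Tendsto (gevTailInv ξ) (𝓝 1) (𝓝 0) := by
    simpa [gevTailInv_one] using (continuousAt_gevTailInv ξ one_pos).tendsto
  rw [tendsto_order]
  constructor
  · intro c hc
    obtain ⟨s, hs, hs1⟩ := ((hq.eventually (lt_mem_nhds hc)).filter_mono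
      nhdsWithin_le_nhds |>.and (self_mem_nhdsWithin (s := Set.Ioi 1))).exists
    filter_upwards [(tendsto_tailIndex_mul S).eventually_lt (h' s (one_pos.trans hs1)) hs1] with u hu
    rw [lt_div_iff₀ (ha _)]
    by_contra! hcon
    have : u ≤ a (tailIndex S u) * gevTailInv ξ s + b (tailIndex S u) := by
      nlinarith [ha (tailIndex S u)]
    have := mul_le_mul_of_nonneg_left (hS this) (Nat.cast_nonneg (α := ℝ) (tailIndex S u))
    linarith
  · intro c hc
    obtain ⟨s, ⟨hs, hs0⟩, hs1⟩ := (((hq.eventually (gt_mem_nhds hc)).and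
      (lt_mem_nhds one_pos)).filter_mono
      nhdsWithin_le_nhds |>.and (self_mem_nhdsWithin (s := Set.Iio 1))).exists
    filter_upwards [(h' s hs0).eventually_lt (tendsto_tailIndex_mul S) hs1] with u hu
    rw [div_lt_iff₀ (ha _)]
    by_contra! hcon
    have : a (tailIndex S u) * gevTailInv ξ s + b (tailIndex S u) ≤ u := by
      nlinarith [ha (tailIndex S u)]
    have := mul_le_mul_of_nonneg_left (hS this) (Nat.cast_nonneg (α := ℝ) (tailIndex S u))
    linarith

lemma tendsto_tail_ratio {S : ℝ → ℝ} (hS : Antitone S) {ξ : ℝ} {a b : ℕ → ℝ}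
    (ha : ∀ n, 0 < a n)
    (h : ∀ s, 0 < s → Tendsto (fun n : ℕ => n * S (a n * gevTailInv ξ s + b n)) atTop (𝓝 s))
    {s : ℝ} (hs : 0 < s) :
    Tendsto (fun u => S (u + a (tailIndex S u) * gevTailInv ξ s) / S u) (tailFilter S) (𝓝 s) := by
  have h' : ∀ t, 0 < t → Tendsto (fun u => tailIndex S u *
      S (a (tailIndex S u) * gevTailInv ξ t + b (tailIndex S u)) / (tailIndex S u * S u))
      (tailFilter S) (𝓝 t) := fun t ht => by
    simpa [Pi.div_def, Function.comp_def] using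
      ((h t ht).comp (tendsto_tailIndex S)).div (tendsto_tailIndex_mul S) one_ne_zero
  have hy := tendsto_standardized_threshold hS ha h
  have hn := (tendsto_tailIndex S).eventually_gt_atTop 0
  rw [tendsto_order]
  constructor
  · intro c hc
    obtain ⟨t, ht, hts⟩ := exists_between (max_lt hc hs)
    have ht0 := (le_max_right _ _).trans_lt ht
    have hct := (le_max_left _ _).trans_lt ht
    have hq : 0 < gevTailInv ξ t - gevTailInv ξ s := by linarith [gevTailInv_lt ξ ht0 hts]
    filter_upwards [(h' t ht0).eventually (lt_mem_nhds hct), hy.eventually (gt_mem_nhds hq), hn,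
      tailFilter_pos S] with u hu1 hu2 hu3 hu4
    refine hu1.trans_le ?_
    rw [mul_div_mul_left _ _ (by positivity)]
    refine div_le_div_of_nonneg_right (hS ?_) hu4.le
    rw [div_lt_iff₀ (ha _)] at hu2
    linarith
  · intro c hc
    obtain ⟨t, hst, htc⟩ := exists_between hc
    have hq : gevTailInv ξ t - gevTailInv ξ s < 0 := by linarith [gevTailInv_lt ξ hs hst]
    filter_upwards [(h' t (hs.trans hst)).eventually (gt_mem_nhds htc),
      hy.eventually (lt_mem_nhds hq), hn, tailFilter_pos S] with u hu1 hu2 hu3 hu4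
    refine lt_of_le_of_lt ?_ hu1
    rw [mul_div_mul_left _ _ (by positivity)]
    refine div_le_div_of_nonneg_right (hS ?_) hu4.le
    rw [lt_div_iff₀ (ha _)] at hu2
    linarith

lemma tendsto_add_scale_tailFilter {S : ℝ → ℝ} {ξ : ℝ} {a : ℝ → ℝ} {s : ℝ} (hs : 0 < s)
    (h : Tendsto (fun u => S (u + a u * gevTailInv ξ s) / S u) (tailFilter S) (𝓝 s)) :
    Tendsto (fun u => u + a u * gevTailInv ξ s) (tailFilter S) (tailFilter S) := by
  refine tendsto_comap_iff.2 (tendsto_nhdsWithin_iff.2 ⟨?_, ?_⟩)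
  · have := h.mul ((tendsto_tailFilter S).mono_right nhdsWithin_le_nhds)
    rw [mul_zero] at this
    refine this.congr' ?_
    filter_upwards [tailFilter_pos S] with u hu
    exact div_mul_cancel₀ _ hu.ne'
  · filter_upwards [tailFilter_pos S, h.eventually (lt_mem_nhds hs)] with u hu hu'
    exact (div_pos_iff_of_pos_right hu).1 hu'

/-- Pólya's argument: monotonicity upgrades pointwise convergence to uniform convergence. -/
lemma eventually_forall_abs_sub_le {ι : Type*} {l : Filter ι} {W : ι → ℝ → ℝ}
    (hmono : ∀ᶠ i in l, MonotoneOn (W i) (Set.Ioc 0 1)) (hpos : ∀ᶠ i in l, ∀ s, 0 ≤ W i s)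
    (h : ∀ s, 0 < s → s ≤ 1 → Tendsto (fun i => W i s) l (𝓝 s)) {ε : ℝ} (hε : 0 < ε) :
    ∀ᶠ i in l, ∀ s, 0 < s → s ≤ 1 → |W i s - s| ≤ ε := by
  obtain ⟨N, hN⟩ := exists_nat_gt (2 / ε)
  have hN0 : (0 : ℝ) < N := lt_trans (by positivity) hN
  have hNε : 2 / N < ε := by rwa [div_lt_comm₀ hN0 hε]
  have hgrid : ∀ᶠ i in l, ∀ k ∈ Finset.Icc 1 N, |W i (k / N) - k / N| < 1 / N := by
    rw [Filter.eventually_all_finset]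
    intro k hk
    obtain ⟨hk1, hk2⟩ := Finset.mem_Icc.1 hk
    have hk1' : (0 : ℝ) < k := by exact_mod_cast hk1
    have hk2' : (k : ℝ) ≤ N := by exact_mod_cast hk2
    have := h (k / N) (by positivity) (by rwa [div_le_one hN0])
    simpa [Real.dist_eq] using this.eventually (Metric.ball_mem_nhds _ (by positivity : 0 < 1 / (N:ℝ)))
  filter_upwards [hmono, hpos, hgrid] with i hm hp hg s hs0 hs1
  have hfl := Nat.floor_le (by positivity : 0 ≤ N * s)
  have hfl' := Nat.lt_floor_add_one (N * s)
  have hkN : ⌊N * s⌋₊ ≤ N := by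
    have : (⌊N * s⌋₊ : ℝ) ≤ N := hfl.trans (mul_le_of_le_one_right hN0.le hs1)
    exact_mod_cast this
  set k := ⌊N * s⌋₊
  have hks : (k : ℝ) / N ≤ s := by rw [div_le_iff₀ hN0]; linarith
  have hsk : s ≤ ((k + 1 : ℕ) : ℝ) / N := by rw [le_div_iff₀ hN0]; push_cast; linarith
  have hsum : ((k + 1 : ℕ) : ℝ) / N = k / N + 1 / N := by push_cast; ring
  have h2 : (2 : ℝ) / N = 1 / N + 1 / N := by ring
  have hNpos : (0 : ℝ) < 1 / N := by positivity
  rw [abs_le]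
  constructor
  · rcases Nat.eq_zero_or_pos k with h0 | h0
    · rw [h0] at hsum hsk
      have := hp s
      simp only [Nat.cast_zero, zero_div] at hsum
      linarith
    · have hk0 : (0 : ℝ) < k := by exact_mod_cast h0
      have h1 := abs_lt.1 (hg k (Finset.mem_Icc.2 ⟨h0, hkN⟩))
      have h3 := hm ⟨by positivity, hks.trans hs1⟩ ⟨hs0, hs1⟩ hks
      linarith [h1.1]
  · rcases hkN.lt_or_eq with h0 | h0
    · have h1 := abs_lt.1 (hg (k + 1) (Finset.mem_Icc.2 ⟨by omega, h0⟩))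
      have hle : ((k + 1 : ℕ) : ℝ) / N ≤ 1 := by
        rw [div_le_one hN0]; exact_mod_cast h0
      have h3 := hm ⟨hs0, hs1⟩ ⟨by positivity, hle⟩ hsk
      linarith [h1.2]
    · have h1 := abs_lt.1 (hg N (Finset.mem_Icc.2 ⟨by exact_mod_cast hN0, le_rfl⟩))
      rw [h0, div_self hN0.ne'] at hks
      obtain rfl : s = 1 := le_antisymm hs1 hks
      rw [div_self hN0.ne'] at h1
      linarith [h1.2]

section Tail

variable {S a : ℝ → ℝ} {ξ : ℝ}

lemma eventually_abs_tail_ratio_sub_le (hS : Antitone S) (hS0 : ∀ u, 0 ≤ S u) (ha : ∀ u, 0 < a u)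
    (h : ∀ s, 0 < s → Tendsto (fun u => S (u + a u * gevTailInv ξ s) / S u) (tailFilter S) (𝓝 s))
    {ε : ℝ} (hε : 0 < ε) :
    ∀ᶠ u in tailFilter S, ∀ s, 0 < s → s ≤ 1 →
      |S (u + a u * gevTailInv ξ s) / S u - s| ≤ ε := by
  refine eventually_forall_abs_sub_le (W := fun u s => S (u + a u * gevTailInv ξ s) / S u)
    (.of_forall fun u s hs t _ hst => ?_) (.of_forall fun u s => div_nonneg (hS0 _) (hS0 _))
    (fun s hs _ => h s hs) hε
  refine div_le_div_of_nonneg_right (hS ?_) (hS0 u)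
  have := mul_le_mul_of_nonneg_left (gevTailInv_le ξ hs.1 hst) (ha u).le
  linarith

lemma gevTailInv_half_pos (ξ : ℝ) : 0 < gevTailInv ξ (1 / 2) :=
  gevTailInv_one ξ ▸ gevTailInv_lt ξ (by norm_num) (by norm_num)

lemma eventually_scale_le (hS : Antitone S)
    (h : ∀ s, 0 < s → Tendsto (fun u => S (u + a u * gevTailInv ξ s) / S u) (tailFilter S) (𝓝 s))
    (ha : ∀ u, 0 < a u) {ρ : ℝ} (hρ : (1 / 2 : ℝ) ^ (-ξ) < ρ) :
    ∀ᶠ u in tailFilter S, a (u + a u * gevTailInv ξ (1 / 2)) ≤ ρ * a u := by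
  set x := gevTailInv ξ (1 / 2) with hx
  have hx0 : 0 < x := gevTailInv_half_pos ξ
  have hquarter : gevTailInv ξ (1 / 4) < x + ρ * x := by
    have := gevTailInv_mul ξ (s := 1 / 2) (t := 1 / 2) (by norm_num) (by norm_num)
    rw [show (1 / 2 : ℝ) * (1 / 2) = 1 / 4 by norm_num, ← hx] at this
    rw [this]
    gcongr
  obtain ⟨r, ⟨hr, hr0⟩, hr1⟩ := ((((continuousAt_gevTailInv ξ (by norm_num : (0 : ℝ) < 1 / 4)).eventually
    (gt_mem_nhds hquarter)).and (lt_mem_nhds (by norm_num : (0 : ℝ) < 1 / 4))).filter_mono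
      nhdsWithin_le_nhds |>.and (self_mem_nhdsWithin (s := Set.Iio (1 / 4)))).exists
  have hshift := tendsto_add_scale_tailFilter (by norm_num) (h (1 / 2) (by norm_num))
  have h1 := (h (1 / 2) (by norm_num)).comp hshift
  have h2 := (h r hr0).div (h (1 / 2) (by norm_num)) (by norm_num)
  have hlt : r / (1 / 2) < 1 / 2 := by
    have : r < 1 / 4 := hr1
    linarith
  filter_upwards [h2.eventually_lt h1 hlt, tailFilter_pos S,
    hshift.eventually (tailFilter_pos S)] with u hu hu0 hu1
  simp only [Function.comp_apply, Pi.div_apply, ← hx] at hu hu1 ⊢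
  by_contra! hcon
  refine hu.not_ge ?_
  rw [div_div_div_cancel_right₀ hu0.ne']
  refine div_le_div_of_nonneg_right (hS ?_) hu1.le
  nlinarith [ha u]

/-- For negative shape, the distance to the right endpoint is asymptotically at most the scale
divided by `-ξ`. -/
lemma eventually_le_of_tail_pos (hS : Antitone S)
    (h : ∀ s, 0 < s → Tendsto (fun u => S (u + a u * gevTailInv ξ s) / S u) (tailFilter S) (𝓝 s))
    (ha : ∀ u, 0 < a u) (hξ : ξ < 0) {δ : ℝ} (hδ : 0 < δ) :
    ∀ᶠ u in tailFilter S, ∀ z, 0 < S (u + a u * z) → z ≤ (1 + δ) / -ξ := by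
  set x := gevTailInv ξ (1 / 2) with hx
  have hx0 : 0 < x := gevTailInv_half_pos ξ
  have hc := one_add_mul_gevTailInv hξ.ne (1 / 2)
  have hc1 : (1 / 2 : ℝ) ^ (-ξ) < 1 - -ξ * x / (1 + δ) := by
    rw [← hc, ← hx]
    have : -ξ * x / (1 + δ) < -ξ * x := div_lt_self (by nlinarith) (by linarith)
    linarith
  set ρ := 1 - -ξ * x / (1 + δ) with hρ
  have hρ1 : ρ < 1 := by
    have : 0 < -ξ * x / (1 + δ) := div_pos (mul_pos (by linarith) hx0) (by linarith)
    linarith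
  have hxρ : x / (1 - ρ) = (1 + δ) / -ξ := by
    rw [hρ, sub_sub_cancel]
    field_simp
  have hstep : x + ρ * (x / (1 - ρ)) = x / (1 - ρ) := by
    have : 1 - ρ ≠ 0 := by linarith
    field_simp
    ring
  have hhalf := h (1 / 2) (by norm_num)
  have hev : ∀ᶠ u in tailFilter S, 0 < S (u + a u * x) ∧ S (u + a u * x) ≤ 3 / 4 * S u ∧
      a (u + a u * x) ≤ ρ * a u := by
    filter_upwards [(tendsto_add_scale_tailFilter (by norm_num) hhalf).eventually (tailFilter_pos S),
      hhalf.eventually (gt_mem_nhds (by norm_num : (1 / 2 : ℝ) < 3 / 4)), tailFilter_pos S,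
      eventually_scale_le hS h ha hc1] with u h1 h2 h3 h4
    exact ⟨h1, ((div_lt_iff₀ h3).1 h2).le, h4⟩
  obtain ⟨η, hη, hP⟩ := eventually_tailFilter hev
  filter_upwards [tailFilter_pos S, (tendsto_tailFilter S).eventually
    (nhdsWithin_le_nhds (gt_mem_nhds hη))] with u hu0 hu1 z hz
  set v : ℕ → ℝ := fun k => (fun u => u + a u * x)^[k] u with hv
  have hvs : ∀ k, v (k + 1) = v k + a (v k) * x := fun k => by
    simp only [hv, Function.iterate_succ_apply']
  have hinv : ∀ k, 0 < S (v k) ∧ S (v k) ≤ (3 / 4) ^ k * S u ∧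
      v k + a (v k) * (x / (1 - ρ)) ≤ u + a u * (x / (1 - ρ)) := by
    intro k
    induction k with
    | zero => simp [hv, hu0]
    | succ k ih =>
      obtain ⟨i1, i2, i3⟩ := ih
      have hlt : S (v k) < η := by
        refine (i2.trans (mul_le_of_le_one_left hu0.le ?_)).trans_lt hu1
        exact pow_le_one₀ (by norm_num) (by norm_num)
      obtain ⟨p1, p2, p3⟩ := hP _ i1 hlt
      rw [← hvs] at p1 p2 p3
      refine ⟨p1, ?_, ?_⟩
      · rw [pow_succ]; linarith
      · refine le_trans ?_ i3
        have hpos : 0 < x / (1 - ρ) := div_pos hx0 (by linarith)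
        have := mul_le_mul_of_nonneg_right p3 hpos.le
        have hs := congrArg (a (v k) * ·) hstep
        rw [hvs k] at this ⊢
        linarith
  obtain ⟨k, hk⟩ := exists_pow_lt_of_lt_one (div_pos hz hu0) (by norm_num : (3 / 4 : ℝ) < 1)
  obtain ⟨-, i2, i3⟩ := hinv k
  rw [lt_div_iff₀ hu0] at hk
  have hlt : u + a u * z < v k := by
    by_contra! hcon
    linarith [hS hcon]
  rw [← hxρ]
  have hpos : 0 < a (v k) * (x / (1 - ρ)) := mul_pos (ha _) (div_pos hx0 (by linarith))
  refine le_of_mul_le_mul_left ?_ (ha u)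
  linarith

lemma eventually_abs_tail_ratio_sub_gpdCDF_le (hS : Antitone S) (hS0 : ∀ u, 0 ≤ S u)
    (ha : ∀ u, 0 < a u)
    (h : ∀ s, 0 < s → Tendsto (fun u => S (u + a u * gevTailInv ξ s) / S u) (tailFilter S) (𝓝 s))
    {ε : ℝ} (hε : 0 < ε) :
    ∀ᶠ u in tailFilter S, ∀ x, 0 ≤ x → 0 < S (u + x) →
      |S (u + x) / S u - (1 - gpdCDF (a u) ξ x)| ≤ ε := by
  have hin : ∀ u, (∀ s, 0 < s → s ≤ 1 → |S (u + a u * gevTailInv ξ s) / S u - s| ≤ ε) →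
      ∀ x, 0 ≤ x → 0 < 1 + ξ * (x / a u) →
      |S (u + x) / S u - (1 - gpdCDF (a u) ξ x)| ≤ ε := by
    intro u hu x hx hpos
    obtain ⟨s, hs0, hs1, hs⟩ := exists_gevTailInv_eq (div_nonneg hx (ha u).le) hpos
    obtain rfl : x = a u * gevTailInv ξ s := by rw [hs, mul_div_cancel₀ _ (ha u).ne']
    rw [gpdCDF_mul_gevTailInv ξ (ha u) hs0, sub_sub_cancel]
    exact hu s hs0 hs1
  rcases le_or_gt 0 ξ with hξ | hξ
  · filter_upwards [eventually_abs_tail_ratio_sub_le hS hS0 ha h hε] with u hu x hx _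
    have := mul_nonneg hξ (div_nonneg hx (ha u).le)
    exact hin u hu x hx (by linarith)
  · set ε' := min (ε / 3) 1
    have hε' : 0 < ε' := by positivity
    have hε3 : ε' ≤ ε / 3 := min_le_left _ _
    have hexp : 0 < -1 / ξ := div_pos_of_neg_of_neg (by norm_num) hξ
    have hδ : 0 < ε' ^ (-ξ) := by positivity
    filter_upwards [eventually_abs_tail_ratio_sub_le hS hS0 ha h hε',
      eventually_le_of_tail_pos hS h ha hξ hδ] with u hu hend x hx hxS
    rcases lt_or_ge 0 (1 + ξ * (x / a u)) with hpos | hneg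
    · exact hin u (fun s h0 h1 => (hu s h0 h1).trans (by linarith)) x hx hpos
    · have hxa : u + a u * (x / a u) = u + x := by rw [mul_div_cancel₀ _ (ha u).ne']
      have hz := hend (x / a u) (by rwa [hxa])
      rw [le_div_iff₀ (by linarith)] at hz
      have hgpd : |1 - gpdCDF (a u) ξ x| ≤ ε' := by
        simp only [gpdCDF, hξ.ne, if_false, sub_sub_cancel, mul_div_assoc]
        refine (Real.abs_rpow_le_abs_rpow _ _).trans ?_
        refine (Real.rpow_le_rpow (abs_nonneg _) ?_ hexp.le).trans_eq
          (rpow_neg_rpow_neg_one_div hξ.ne hε')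
        rw [abs_le]
        constructor <;> linarith
      have hratio : S (u + x) / S u ≤ 2 * ε' := by
        have h1 := (abs_le.1 (hu ε' hε' (min_le_right _ _))).2
        have hq := one_add_mul_gevTailInv_pos ξ hε'
        have hle : gevTailInv ξ ε' ≤ x / a u := by nlinarith
        have h2 : S (u + x) / S u ≤ S (u + a u * gevTailInv ξ ε') / S u := by
          refine div_le_div_of_nonneg_right (hS ?_) (hS0 u)
          rw [← hxa]
          have := mul_le_mul_of_nonneg_left hle (ha u).le
          linarith
        linarith
      have hnn := div_nonneg (hS0 (u + x)) (hS0 u)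
      rw [abs_le] at hgpd ⊢
      constructor <;> linarith [hgpd.1, hgpd.2]

end Tail

lemma lt_one_of_lt_rightEndpoint {F : ℝ → ℝ} (hF : Monotone F) {u : ℝ}
    (hu : (u : EReal) < rightEndpoint F) : F u < 1 := by
  obtain ⟨_, ⟨t, ht, rfl⟩, hut⟩ := lt_sSup_iff.1 hu
  exact (hF (EReal.coe_lt_coe_iff.1 hut).le).trans_lt ht

lemma tendsto_comap_rightEndpoint_tailFilter {F : ℝ → ℝ} (hF : Monotone F)
    (hsmall : ∀ δ > 0, ∃ t, 0 < 1 - F t ∧ 1 - F t < δ) :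
    comap (fun u : ℝ => (u : EReal)) (𝓝[<] rightEndpoint F) ≤ tailFilter fun u => 1 - F u := by
  have hlt : ∀ᶠ u : ℝ in comap (fun u : ℝ => (u : EReal)) (𝓝[<] rightEndpoint F),
      (u : EReal) < rightEndpoint F := tendsto_comap.eventually self_mem_nhdsWithin
  refine tendsto_id'.1 (tendsto_comap_iff.2 (tendsto_nhdsWithin_iff.2 ⟨?_, ?_⟩))
  · rw [tendsto_order]
    constructor
    · intro c hc
      filter_upwards [hlt] with u hu
      have := lt_one_of_lt_rightEndpoint hF hu
      simp only [Function.comp_apply, id]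
      linarith
    · intro δ hδ
      obtain ⟨t, ht0, htδ⟩ := hsmall δ hδ
      obtain ⟨t', ht'0, ht't⟩ := hsmall _ ht0
      have htt' : t < t' := by
        by_contra! hcon
        linarith [hF hcon]
      have htx : (t : EReal) < rightEndpoint F := by
        refine (EReal.coe_lt_coe_iff.2 htt').trans_le (le_sSup ⟨t', ?_, rfl⟩)
        change F t' < 1
        linarith
      have : ∀ᶠ u : ℝ in comap (fun u : ℝ => (u : EReal)) (𝓝[<] rightEndpoint F),
          (t : EReal) < u :=
        tendsto_comap.eventually (nhdsWithin_le_nhds (lt_mem_nhds htx))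
      filter_upwards [this] with u hu
      have := hF (EReal.coe_lt_coe_iff.1 hu).le
      simp only [Function.comp_apply, id]
      linarith
  · filter_upwards [hlt] with u hu
    exact Set.mem_Ioi.2 (sub_pos.2 (lt_one_of_lt_rightEndpoint hF hu))

/-- **Pickands–Balkema–de Haan theorem (one direction).**
If the CDF `F` lies in the maximum domain of attraction of the GEV distribution with
shape `ξ` (i.e. there are normalizing sequences `a n > 0`, `b n` with
`F (a n * x + b n) ^ n → gevCDF ξ x` for all `x` with `1 + ξ x > 0`),
then there is a positive measurable scale function `u ↦ σ u` such that
`sup_{0 ≤ x < x_F - u} |(F (x + u) - F u) / (1 - F u) - G (x; σ u, ξ)| → 0`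
as `u → x_F` (from below). -/
theorem pickands_balkema_deHaan
    (F : ℝ → ℝ) (hmono : Monotone F)
    (hrc : ∀ x, ContinuousWithinAt F (Set.Ici x) x)
    (hbot : Tendsto F atBot (𝓝 0)) (htop : Tendsto F atTop (𝓝 1))
    (ξ : ℝ)
    (hMDA : ∃ a b : ℕ → ℝ, (∀ n, 0 < a n) ∧
      ∀ x : ℝ, 1 + ξ * x > 0 →
        Tendsto (fun n => (F (a n * x + b n)) ^ n) atTop (𝓝 (gevCDF ξ x))) :
    ∃ σ : ℝ → ℝ, (∀ u, 0 < σ u) ∧ Measurable σ ∧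
      Tendsto
        (fun u : ℝ =>
          ⨆ x : {x : ℝ // 0 ≤ x ∧ ((x + u : ℝ) : EReal) < rightEndpoint F},
            |(F (x.1 + u) - F u) / (1 - F u) - gpdCDF (σ u) ξ x.1|)
        (comap (fun u : ℝ => (u : EReal)) (𝓝[<] rightEndpoint F))
        (𝓝 0) := by
  obtain ⟨a, b, ha, hab⟩ := hMDA
  have hF0 : ∀ u, 0 ≤ F u := hmono.le_of_tendsto hbot
  have hF1 : ∀ u, F u ≤ 1 := hmono.ge_of_tendsto htop
  set S : ℝ → ℝ := fun u => 1 - F u with hSdef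
  have hS : Antitone S := fun u v huv => sub_le_sub_left (hmono huv) 1
  have hS0 : ∀ u, 0 ≤ S u := fun u => sub_nonneg.2 (hF1 u)
  have hseq : ∀ s, 0 < s →
      Tendsto (fun n : ℕ => n * S (a n * gevTailInv ξ s + b n)) atTop (𝓝 s) := fun s hs =>
    tendsto_mul_one_sub_of_tendsto_pow (fun n => hF0 _)
      (gevCDF_gevTailInv ξ hs ▸ hab _ (one_add_mul_gevTailInv_pos ξ hs))
  have hsmall : ∀ δ > 0, ∃ t, 0 < 1 - F t ∧ 1 - F t < δ := by
    intro δ hδ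
    have h1 := hseq 1 one_pos
    have h0 := h1.div_atTop (tendsto_natCast_atTop_atTop (R := ℝ))
    obtain ⟨n, hn1, hn0, hn⟩ := ((h1.eventually (lt_mem_nhds one_pos)).and
      ((h0.eventually (gt_mem_nhds hδ)).and (eventually_gt_atTop 0))).exists
    have hn' : (0 : ℝ) < n := by exact_mod_cast hn
    rw [mul_div_cancel_left₀ _ hn'.ne'] at hn0
    exact ⟨_, (mul_pos_iff_of_pos_left hn').1 hn1, hn0⟩
  refine ⟨fun u => a (tailIndex S u), fun u => ha _, ?_, ?_⟩
  · have hSm : Measurable S := measurable_const.sub hmono.measurable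
    exact (measurable_from_nat (f := a)).comp (Nat.measurable_floor.comp hSm.inv)
  · have hle := tendsto_comap_rightEndpoint_tailFilter hmono hsmall
    have hlim := fun s hs => tendsto_tail_ratio hS ha hseq (s := s) hs
    rw [Metric.tendsto_nhds]
    intro ε hε
    filter_upwards [hle (eventually_abs_tail_ratio_sub_gpdCDF_le hS hS0
      (a := fun u => a (tailIndex S u)) (fun u => ha _) hlim (half_pos hε)),
      hle (tailFilter_pos S)] with u hu hu0
    rw [Real.dist_eq, sub_zero, abs_of_nonneg (Real.iSup_nonneg fun _ => abs_nonneg _)]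
    refine (Real.iSup_le (fun x => ?_) (half_pos hε).le).trans_lt (half_lt_self hε)
    obtain ⟨x, hx0, hx⟩ := x
    have hxS : 0 < S (u + x) := by
      rw [add_comm]
      exact sub_pos.2 (lt_one_of_lt_rightEndpoint hmono hx)
    refine le_of_eq_of_le ?_ (hu x hx0 hxS)
    have hratio : (F (x + u) - F u) / (1 - F u) = 1 - S (u + x) / S u := by
      rw [eq_sub_iff_add_eq, hSdef, add_comm u x, ← add_div]
      exact (div_eq_one_iff_eq hu0.ne').2 (by ring)
    rw [hratio, ← abs_neg]
    congr 1
    ring
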